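/- For x in the Weyl chamber and even N, 𝒩_N(t,x) = Pf_{1≤i<j≤N}( Ψ((x_j - x_i)/(2√t)) ), where Ψ(u) = (2/√π)∫_0^u e^{-v²}dv and 𝒩_N(t,x) = ∫_{y_1<...<y_N} det_{1≤i,j≤N}((2πt)^{-1/2} e^{-(x_j-y_i)²/(2t)}) dy. -/

import Mathlib

open Finset MeasureTheory Real

/-- The Pfaffian `Pf(A) = (1/M!) Σ_{σ : σ(2k-1)<σ(2k)} sgn(σ) ∏_k A(σ(2k-1), σ(2k))`
of a `2M × 2M` array, using only the entries `A i j` with `i < j`. -/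
noncomputable def pfaffian {M : ℕ} (A : Fin (2 * M) → Fin (2 * M) → ℝ) : ℝ :=
  (1 / (M.factorial : ℝ)) *
    ∑ σ ∈ Finset.univ.filter (fun σ : Equiv.Perm (Fin (2 * M)) =>
        ∀ k : Fin M, σ ⟨2 * k, by have := k.isLt; omega⟩ <
          σ ⟨2 * k + 1, by have := k.isLt; omega⟩),
      (Equiv.Perm.sign σ : ℝ) *
        ∏ k : Fin M, A (σ ⟨2 * k, by have := k.isLt; omega⟩)
          (σ ⟨2 * k + 1, by have := k.isLt; omega⟩)

/-- The position `2k` of the first element of the `k`-th pair. -/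
def firstIdx {M : ℕ} (k : Fin M) : Fin (2 * M) := ⟨2 * k, by have := k.isLt; omega⟩

/-- The position `2k + 1` of the second element of the `k`-th pair. -/
def secondIdx {M : ℕ} (k : Fin M) : Fin (2 * M) := ⟨2 * k + 1, by have := k.isLt; omega⟩

theorem firstIdx_inj {M : ℕ} {k l : Fin M} : firstIdx k = firstIdx l ↔ k = l := by
  simp [firstIdx, Fin.ext_iff]

theorem secondIdx_inj {M : ℕ} {k l : Fin M} : secondIdx k = secondIdx l ↔ k = l := by
  simp [secondIdx, Fin.ext_iff]

theorem firstIdx_ne_secondIdx {M : ℕ} (k l : Fin M) : firstIdx k ≠ secondIdx l := by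
  simp only [firstIdx, secondIdx, ne_eq, Fin.mk.injEq]
  omega

/-- The splitting of `Fin (2 * M)` into even and odd positions. -/
noncomputable def pairEquiv (M : ℕ) : Fin M ⊕ Fin M ≃ Fin (2 * M) :=
  Equiv.ofBijective (Sum.elim firstIdx secondIdx) <| by
    refine ⟨?_, fun i => ?_⟩
    · rintro (k | k) (l | l) h <;>
        simp only [Sum.elim_inl, Sum.elim_inr, firstIdx, secondIdx, Sum.inl.injEq,
          Sum.inr.injEq, Fin.ext_iff] at h ⊢ <;> omega
    · have hi := i.isLt
      rcases Nat.even_or_odd' i with ⟨c, hc | hc⟩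
      · exact ⟨Sum.inl ⟨c, by omega⟩, Fin.ext hc.symm⟩
      · exact ⟨Sum.inr ⟨c, by omega⟩, Fin.ext hc.symm⟩

@[simp] theorem pairEquiv_inl {M : ℕ} (k : Fin M) : pairEquiv M (Sum.inl k) = firstIdx k := rfl

@[simp] theorem pairEquiv_inr {M : ℕ} (k : Fin M) : pairEquiv M (Sum.inr k) = secondIdx k := rfl

theorem pairEquiv_symm_firstIdx {M : ℕ} (k : Fin M) :
    (pairEquiv M).symm (firstIdx k) = Sum.inl k := by simp [Equiv.symm_apply_eq]

theorem pairEquiv_symm_secondIdx {M : ℕ} (k : Fin M) :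
    (pairEquiv M).symm (secondIdx k) = Sum.inr k := by simp [Equiv.symm_apply_eq]

theorem prod_eq_prod_pairs {M : ℕ} (f : Fin (2 * M) → ℝ) :
    ∏ i, f i = ∏ k : Fin M, f (firstIdx k) * f (secondIdx k) := by
  rw [← (pairEquiv M).prod_comp, Fintype.prod_sum_type, Finset.prod_mul_distrib]
  rfl

/-- The alternating sum over permutations of products over the `M` consecutive pairs. -/
noncomputable def pairSum {M : ℕ} (f : Fin M → Fin (2 * M) → Fin (2 * M) → ℝ) : ℝ :=
  ∑ σ : Equiv.Perm (Fin (2 * M)), (Equiv.Perm.sign σ : ℝ) *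
    ∏ k : Fin M, f k (σ (firstIdx k)) (σ (secondIdx k))

theorem pairSum_eq_zero_of_symm {M : ℕ} {f : Fin M → Fin (2 * M) → Fin (2 * M) → ℝ} (k : Fin M)
    (hf : ∀ i j, f k i j = f k j i) : pairSum f = 0 := by
  have key : pairSum f = -pairSum f := by
    refine (Equiv.sum_comp (Equiv.mulRight (Equiv.swap (firstIdx k) (secondIdx k))) _).symm.trans ?_
    rw [pairSum, ← Finset.sum_neg_distrib]
    refine Finset.sum_congr rfl fun σ _ => ?_
    have hprod : ∀ l : Fin M,
        f l ((σ * Equiv.swap (firstIdx k) (secondIdx k)) (firstIdx l))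
          ((σ * Equiv.swap (firstIdx k) (secondIdx k)) (secondIdx l)) =
        f l (σ (firstIdx l)) (σ (secondIdx l)) := by
      intro l
      by_cases h : l = k
      · subst h
        simp [hf]
      · rw [Equiv.Perm.mul_apply, Equiv.Perm.mul_apply,
          Equiv.swap_apply_of_ne_of_ne (by rwa [ne_eq, firstIdx_inj]) (firstIdx_ne_secondIdx _ _),
          Equiv.swap_apply_of_ne_of_ne (firstIdx_ne_secondIdx _ _).symm
            (by rwa [ne_eq, secondIdx_inj])]
    simp only [Equiv.coe_mulRight, hprod]
    simp [Equiv.Perm.sign_swap (firstIdx_ne_secondIdx k k)]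
  linarith

theorem pairSum_update_sub {M : ℕ} (f : Fin M → Fin (2 * M) → Fin (2 * M) → ℝ) (k : Fin M)
    (u v : Fin (2 * M) → Fin (2 * M) → ℝ) :
    pairSum (Function.update f k u) - pairSum (Function.update f k v) =
      pairSum (Function.update f k (u - v)) := by
  have hprod : ∀ (w : Fin (2 * M) → Fin (2 * M) → ℝ) (σ : Equiv.Perm (Fin (2 * M))),
      ∏ l : Fin M, Function.update f k w l (σ (firstIdx l)) (σ (secondIdx l)) =
        w (σ (firstIdx k)) (σ (secondIdx k)) *
          ∏ l ∈ {k}ᶜ, f l (σ (firstIdx l)) (σ (secondIdx l)) := by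
    intro w σ
    rw [Fintype.prod_eq_mul_prod_compl k, Function.update_self]
    congr 1
    refine Finset.prod_congr rfl fun l hl => ?_
    rw [Function.update_of_ne (by simpa using hl)]
  simp only [pairSum, hprod, ← Finset.sum_sub_distrib, Pi.sub_apply]
  refine Finset.sum_congr rfl fun σ _ => ?_
  ring

/-- `pairSum` depends only on the antisymmetrization of the array. -/
theorem pairSum_congr_of_antisymm {M : ℕ} {f g : Fin (2 * M) → Fin (2 * M) → ℝ}
    (h : ∀ i j, f i j - f j i = g i j - g j i) :
    pairSum (fun _ : Fin M => f) = pairSum (fun _ : Fin M => g) := by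
  have hS : ∀ S : Finset (Fin M),
      pairSum (fun k => if k ∈ S then f else g) = pairSum (fun _ : Fin M => g) := by
    intro S
    induction S using Finset.induction_on with
    | empty => simp
    | insert k S hk ih =>
      rw [← ih, ← sub_eq_zero]
      have h1 : (fun l => if l ∈ insert k S then f else g) =
          Function.update (fun l => if l ∈ S then f else g) k f := by
        ext l
        by_cases hl : l = k <;> simp [hl]
      have h2 : (fun l => if l ∈ S then f else g) =
          Function.update (fun l => if l ∈ S then f else g) k g := by
        simp [hk]
      rw [h1]
      conv_lhs => arg 2; rw [h2]
      rw [pairSum_update_sub]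
      refine pairSum_eq_zero_of_symm k fun i j => ?_
      simp only [Function.update_self, Pi.sub_apply]
      linarith [h i j]
  simpa using hS Finset.univ

theorem pfaffian_eq_pairSum {M : ℕ} (A : Fin (2 * M) → Fin (2 * M) → ℝ) :
    pfaffian A = (1 / (M.factorial : ℝ)) *
      pairSum (fun (_ : Fin M) i j => if i < j then A i j else 0) := by
  rw [pfaffian, pairSum, Finset.sum_filter]
  congr 1
  refine Finset.sum_congr rfl fun σ _ => ?_
  rw [Finset.prod_ite_zero, mul_ite, mul_zero]
  simp [firstIdx, secondIdx]

/-- The permutation of `Fin (2 * M)` that permutes the consecutive pairs. -/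
noncomputable def blockPerm {M : ℕ} (ρ : Equiv.Perm (Fin M)) : Equiv.Perm (Fin (2 * M)) :=
  (pairEquiv M).permCongr (Equiv.sumCongr ρ ρ)

theorem blockPerm_firstIdx {M : ℕ} (ρ : Equiv.Perm (Fin M)) (k : Fin M) :
    blockPerm ρ (firstIdx k) = firstIdx (ρ k) := by
  simp [blockPerm, Equiv.permCongr_apply, pairEquiv_symm_firstIdx]

theorem blockPerm_secondIdx {M : ℕ} (ρ : Equiv.Perm (Fin M)) (k : Fin M) :
    blockPerm ρ (secondIdx k) = secondIdx (ρ k) := by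
  simp [blockPerm, Equiv.permCongr_apply, pairEquiv_symm_secondIdx]

theorem sign_blockPerm {M : ℕ} (ρ : Equiv.Perm (Fin M)) :
    Equiv.Perm.sign (blockPerm ρ) = 1 := by
  rw [blockPerm, Equiv.Perm.sign_permCongr, Equiv.Perm.sign_sumCongr, Int.units_mul_self]

/-- The index of the pair containing a position. -/
def pairOf {M : ℕ} (i : Fin (2 * M)) : Fin M := ⟨i / 2, by have := i.isLt; omega⟩

theorem pairOf_firstIdx {M : ℕ} (k : Fin M) : pairOf (firstIdx k) = k := by
  simp [pairOf, firstIdx]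

theorem pairOf_secondIdx {M : ℕ} (k : Fin M) : pairOf (secondIdx k) = k := by
  simp only [pairOf, secondIdx, Fin.ext_iff]; omega

/-- The pairs of values that a permutation places in different pairs of positions. -/
def splitPairs {M : ℕ} (σ : Equiv.Perm (Fin (2 * M))) : Finset (Fin M) :=
  {l | pairOf (σ.symm (firstIdx l)) ≠ pairOf (σ.symm (secondIdx l))}

theorem splitPairs_swap_mul {M : ℕ} (σ : Equiv.Perm (Fin (2 * M))) (l : Fin M) :
    splitPairs (Equiv.swap (firstIdx l) (secondIdx l) * σ) = splitPairs σ := by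
  ext m
  simp only [splitPairs, Finset.mem_filter_univ]
  change pairOf (σ.symm ((Equiv.swap (firstIdx l) (secondIdx l)).symm _)) ≠
    pairOf (σ.symm ((Equiv.swap (firstIdx l) (secondIdx l)).symm _)) ↔ _
  rw [Equiv.symm_swap]
  by_cases h : m = l
  · subst h
    simp [ne_comm]
  · rw [Equiv.swap_apply_of_ne_of_ne (by rwa [ne_eq, firstIdx_inj]) (firstIdx_ne_secondIdx _ _),
      Equiv.swap_apply_of_ne_of_ne (firstIdx_ne_secondIdx _ _).symm
        (by rwa [ne_eq, secondIdx_inj])]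

theorem swap_lt_swap_of_mem_splitPairs {M : ℕ} {σ : Equiv.Perm (Fin (2 * M))} {l k : Fin M}
    (hl : l ∈ splitPairs σ) (h : σ (firstIdx k) < σ (secondIdx k)) :
    Equiv.swap (firstIdx l) (secondIdx l) (σ (firstIdx k)) <
      Equiv.swap (firstIdx l) (secondIdx l) (σ (secondIdx k)) := by
  have hne : ¬ (σ (firstIdx k) = firstIdx l ∧ σ (secondIdx k) = secondIdx l) := by
    rintro ⟨h1, h2⟩
    simp [splitPairs, ← h1, ← h2, pairOf_firstIdx, pairOf_secondIdx] at hl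
  generalize σ (firstIdx k) = i at *
  generalize σ (secondIdx k) = j at *
  simp only [Equiv.swap_apply_def]
  simp only [firstIdx, secondIdx, Fin.ext_iff, Fin.lt_def] at *
  split_ifs <;> simp_all <;> omega

theorem exists_blockPerm_eq {M : ℕ} {σ : Equiv.Perm (Fin (2 * M))}
    (hσ : ∀ k : Fin M, σ (firstIdx k) < σ (secondIdx k)) (hs : splitPairs σ = ∅) :
    ∃ ρ : Equiv.Perm (Fin M), blockPerm ρ = σ := by
  have hpair : ∀ l, ∃ k, σ (firstIdx k) = firstIdx l ∧ σ (secondIdx k) = secondIdx l := by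
    intro l
    have hl : pairOf (σ.symm (firstIdx l)) = pairOf (σ.symm (secondIdx l)) := by
      by_contra hc
      have : l ∈ splitPairs σ := by simpa [splitPairs] using hc
      simp [hs] at this
    have hne : σ.symm (firstIdx l) ≠ σ.symm (secondIdx l) := by
      simpa using firstIdx_ne_secondIdx l l
    have hk := hσ (pairOf (σ.symm (firstIdx l)))
    refine ⟨pairOf (σ.symm (firstIdx l)), ?_⟩
    have hlt : firstIdx l < secondIdx l := by simp [firstIdx, secondIdx]
    set i := σ.symm (firstIdx l) with hi
    set j := σ.symm (secondIdx l) with hj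
    have hfi : σ i = firstIdx l := by simp [hi]
    have hfj : σ j = secondIdx l := by simp [hj]
    have hcases : (i = firstIdx (pairOf i) ∧ j = secondIdx (pairOf i)) ∨
        (j = firstIdx (pairOf i) ∧ i = secondIdx (pairOf i)) := by
      simp only [pairOf, firstIdx, secondIdx, Fin.ext_iff, ne_eq] at hl hne ⊢
      omega
    rcases hcases with ⟨h1, h2⟩ | ⟨h1, h2⟩
    · rw [← h1, ← h2]; exact ⟨hfi, hfj⟩
    · rw [← h1, ← h2, hfi, hfj] at hk
      exact absurd hlt hk.asymm
  choose τ hτ using hpair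
  have hinj : Function.Injective τ := fun l m h => by
    rw [← firstIdx_inj, ← (hτ l).1, ← (hτ m).1, h]
  let ρ : Equiv.Perm (Fin M) := Equiv.ofBijective τ (Finite.injective_iff_bijective.1 hinj)
  refine ⟨ρ.symm, Equiv.ext fun i => ?_⟩
  have hρ : ∀ k, τ (ρ.symm k) = k := fun k => ρ.apply_symm_apply k
  obtain ⟨k | k, rfl⟩ := (pairEquiv M).surjective i
  · rw [pairEquiv_inl, blockPerm_firstIdx, ← (hτ _).1, hρ]
  · rw [pairEquiv_inr, blockPerm_secondIdx, ← (hτ _).2, hρ]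

theorem pairSum_lt {M : ℕ} :
    pairSum (fun (_ : Fin M) i j => if i < j then 1 else 0) = (M.factorial : ℝ) := by
  simp only [pairSum, Finset.prod_ite_zero, Finset.prod_const_one, mul_ite, mul_one, mul_zero,
    Finset.mem_univ, true_imp_iff]
  rw [← Finset.sum_filter, ← Finset.sum_filter_add_sum_filter_not _ (fun σ => splitPairs σ = ∅)]
  have hsplit : ∑ σ ∈ Finset.univ.filter (fun σ : Equiv.Perm (Fin (2 * M)) =>
      ∀ k, σ (firstIdx k) < σ (secondIdx k)) with ¬ splitPairs σ = ∅,
      (Equiv.Perm.sign σ : ℝ) = 0 := by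
    have hmem : ∀ σ ∈ ({σ ∈ Finset.univ.filter (fun σ : Equiv.Perm (Fin (2 * M)) =>
        ∀ k, σ (firstIdx k) < σ (secondIdx k)) | ¬ splitPairs σ = ∅} : Finset _),
        (splitPairs σ).Nonempty := fun σ hσ =>
      Finset.nonempty_iff_ne_empty.2 (Finset.mem_filter.1 hσ).2
    refine Finset.sum_involution (fun σ hσ =>
      Equiv.swap (firstIdx ((splitPairs σ).min' (hmem σ hσ)))
        (secondIdx ((splitPairs σ).min' (hmem σ hσ))) * σ) ?_ ?_ ?_ ?_
    · intro σ hσ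
      simp [Equiv.Perm.sign_swap (firstIdx_ne_secondIdx _ _)]
    · intro σ hσ _ h
      simpa [Equiv.Perm.sign_swap (firstIdx_ne_secondIdx _ _)] using
        congrArg Equiv.Perm.sign (mul_eq_right.1 h)
    · intro σ hσ
      have hσ' := hσ
      simp only [Finset.mem_filter, Finset.mem_univ, true_and] at hσ' ⊢
      rw [splitPairs_swap_mul]
      exact ⟨fun k => swap_lt_swap_of_mem_splitPairs (Finset.min'_mem _ _) (hσ'.1 k), hσ'.2⟩
    · intro σ hσ
      simp only [splitPairs_swap_mul]
      rw [← mul_assoc, Equiv.swap_mul_self, one_mul]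
  rw [hsplit, add_zero]
  have himage : ({σ ∈ Finset.univ.filter (fun σ : Equiv.Perm (Fin (2 * M)) =>
      ∀ k, σ (firstIdx k) < σ (secondIdx k)) | splitPairs σ = ∅} : Finset _) =
      Finset.univ.image blockPerm := by
    ext σ
    simp only [Finset.mem_filter, Finset.mem_univ, true_and, Finset.mem_image]
    refine ⟨fun h => exists_blockPerm_eq h.1 h.2, ?_⟩
    rintro ⟨ρ, rfl⟩
    refine ⟨fun k => ?_, ?_⟩
    · rw [blockPerm_firstIdx, blockPerm_secondIdx]
      simp [firstIdx, secondIdx]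
    · ext l
      have h1 : (blockPerm ρ).symm (firstIdx l) = firstIdx (ρ.symm l) := by
        rw [Equiv.symm_apply_eq, blockPerm_firstIdx, Equiv.apply_symm_apply]
      have h2 : (blockPerm ρ).symm (secondIdx l) = secondIdx (ρ.symm l) := by
        rw [Equiv.symm_apply_eq, blockPerm_secondIdx, Equiv.apply_symm_apply]
      simp [splitPairs, h1, h2, pairOf_firstIdx, pairOf_secondIdx]
  have hinj : Function.Injective (blockPerm (M := M)) := fun τ ρ h => Equiv.ext fun k => by
    rw [← firstIdx_inj, ← blockPerm_firstIdx, ← blockPerm_firstIdx, h]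
  rw [himage, Finset.sum_image hinj.injOn]
  simp [sign_blockPerm, Fintype.card_perm]

theorem coe_piCongrLeft_perm_symm {n : ℕ} (σ : Equiv.Perm (Fin n)) :
    ⇑(MeasurableEquiv.piCongrLeft (fun _ : Fin n => ℝ) σ.symm) = fun y => y ∘ σ := by
  ext y i
  obtain ⟨j, rfl⟩ := σ.symm.surjective i
  rw [MeasurableEquiv.coe_piCongrLeft, Equiv.piCongrLeft_apply_apply]
  simp

theorem measurePreserving_comp_perm {n : ℕ} (σ : Equiv.Perm (Fin n)) :
    MeasurePreserving (fun y : Fin n → ℝ => y ∘ σ) := by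
  rw [← coe_piCongrLeft_perm_symm]
  exact volume_measurePreserving_piCongrLeft (fun _ : Fin n => ℝ) σ.symm

theorem integral_comp_perm {n : ℕ} (σ : Equiv.Perm (Fin n)) (G : (Fin n → ℝ) → ℝ) :
    ∫ y, G (y ∘ σ) = ∫ y, G y := by
  rw [← (volume_measurePreserving_piCongrLeft (fun _ : Fin n => ℝ) σ.symm).integral_comp' G,
    coe_piCongrLeft_perm_symm]

theorem ae_injective (n : ℕ) : ∀ᵐ y : Fin n → ℝ, Function.Injective y := by
  have h : ∀ i j : Fin n, i ≠ j → ∀ᵐ y : Fin n → ℝ, y i ≠ y j := by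
    intro i j hij
    let L : (Fin n → ℝ) →ₗ[ℝ] ℝ := LinearMap.proj (R := ℝ) (φ := fun _ => ℝ) i - LinearMap.proj j
    have hL : LinearMap.ker L ≠ ⊤ := by
      intro htop
      have : Pi.single i 1 ∈ LinearMap.ker L := htop ▸ Submodule.mem_top
      simp [L, hij.symm] at this
    filter_upwards [measure_eq_zero_iff_ae_notMem.1
      (Measure.addHaar_submodule volume (LinearMap.ker L) hL)] with y hy hc
    exact hy (by simp [L, hc])
  have h' : ∀ᵐ y : Fin n → ℝ, ∀ i j : Fin n, i ≠ j → y i ≠ y j := by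
    simpa only [ae_all_iff, Filter.eventually_imp_distrib_left] using h
  filter_upwards [h'] with y hy i j hij
  by_contra hne
  exact hy i j hne hij

theorem measurableSet_strictMono (n : ℕ) : MeasurableSet {y : Fin n → ℝ | StrictMono y} := by
  simp only [StrictMono, Set.ofPred_forall]
  exact .iInter fun i => .iInter fun j => .iInter fun _ =>
    measurableSet_lt (measurable_pi_apply i) (measurable_pi_apply j)

theorem existsUnique_strictMono_comp_perm {n : ℕ} {y : Fin n → ℝ} (hy : Function.Injective y) :
    ∃! σ : Equiv.Perm (Fin n), StrictMono (y ∘ σ) := by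
  refine ⟨Tuple.sort y, (Tuple.monotone_sort y).strictMono_of_injective
    (hy.comp (Tuple.sort y).injective), fun σ hσ => ?_⟩
  have h := Tuple.unique_monotone hσ.monotone (Tuple.monotone_sort y)
  exact Equiv.ext fun i => hy (congrFun h i)

/-- Integrating over `ℝⁿ` amounts to summing over all orderings of the coordinates. -/
theorem integral_eq_sum_setIntegral_strictMono {n : ℕ} {G : (Fin n → ℝ) → ℝ}
    (hG : Integrable G) :
    ∫ y, G y = ∑ σ : Equiv.Perm (Fin n), ∫ y in {y | StrictMono y}, G (y ∘ σ) := by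
  have hterm : ∀ σ : Equiv.Perm (Fin n), ∫ y in {y | StrictMono y}, G (y ∘ σ) =
      ∫ y, {y : Fin n → ℝ | StrictMono (y ∘ σ.symm)}.indicator G y := by
    intro σ
    rw [← integral_indicator (measurableSet_strictMono n),
      ← integral_comp_perm σ (Set.indicator _ G)]
    congr 1 with y
    have : (y ∘ σ) ∘ σ.symm = y := by ext; simp
    simp [Set.indicator_apply, this]
  have hmeas : ∀ σ : Equiv.Perm (Fin n),
      MeasurableSet {y : Fin n → ℝ | StrictMono (y ∘ σ.symm)} := fun σ =>
    (measurePreserving_comp_perm σ.symm).measurable (measurableSet_strictMono n)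
  simp only [hterm]
  rw [← integral_finsetSum _ fun σ _ => hG.indicator (hmeas σ)]
  refine integral_congr_ae ?_
  filter_upwards [ae_injective n] with y hy
  obtain ⟨σ, hσ, huniq⟩ := existsUnique_strictMono_comp_perm hy
  rw [Finset.sum_eq_single σ.symm]
  · simpa [Set.indicator_apply] using fun h => absurd hσ h
  · intro τ _ hτ
    refine Set.indicator_of_notMem (fun h => hτ ?_) _
    rw [← huniq _ h, Equiv.symm_symm]
  · simp

/-- Integrals over `ℝ^(2M)` of products over consecutive pairs of coordinates factorize. -/
theorem integral_prod_pairs {M : ℕ} (F : Fin M → ℝ → ℝ → ℝ) :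
    ∫ y : Fin (2 * M) → ℝ, ∏ k, F k (y (firstIdx k)) (y (secondIdx k)) =
      ∏ k, ∫ p : ℝ × ℝ, F k p.1 p.2 := by
  rw [← integral_fintype_prod_volume_eq_prod (fun k (p : ℝ × ℝ) => F k p.1 p.2),
    ← (volume_measurePreserving_piCongrLeft (fun _ => ℝ) (pairEquiv M)).integral_comp',
    ← (volume_measurePreserving_sumPiEquivProdPi_symm
      (fun _ : Fin M ⊕ Fin M => ℝ)).integral_comp',
    ← (volume_measurePreserving_arrowProdEquivProdArrow ℝ ℝ (Fin M)).integral_comp']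
  congr 1 with p
  refine Finset.prod_congr rfl fun k _ => ?_
  rw [← pairEquiv_inl, ← pairEquiv_inr]
  simp only [MeasurableEquiv.coe_piCongrLeft, Equiv.piCongrLeft_apply_apply]
  rfl

theorem det_eq_sum_sign_mul_prod {M : ℕ} (φ : Fin (2 * M) → ℝ → ℝ) (y : Fin (2 * M) → ℝ) :
    Matrix.det (Matrix.of fun i j => φ j (y i)) =
      ∑ σ : Equiv.Perm (Fin (2 * M)), (Equiv.Perm.sign σ : ℝ) *
        ∏ i, φ (σ i) (y i) := by
  rw [← Matrix.det_transpose, Matrix.det_apply']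
  rfl

theorem integrable_prod_apply {n : ℕ} {φ : Fin n → ℝ → ℝ} (hφ : ∀ j, Integrable (φ j))
    (σ : Equiv.Perm (Fin n)) : Integrable fun y : Fin n → ℝ => ∏ i, φ (σ i) (y i) :=
  Integrable.fintype_prod fun i => hφ (σ i)

theorem measurableSet_pairs_lt (M : ℕ) :
    MeasurableSet {y : Fin (2 * M) → ℝ | ∀ k : Fin M, y (firstIdx k) < y (secondIdx k)} := by
  simp only [Set.ofPred_forall]
  exact .iInter fun k => measurableSet_lt (measurable_pi_apply _) (measurable_pi_apply _)

theorem setIntegral_pairs_lt_det_eq_pairSum {M : ℕ} {φ : Fin (2 * M) → ℝ → ℝ}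
    (hφ : ∀ j, Integrable (φ j)) :
    ∫ y in {y : Fin (2 * M) → ℝ | ∀ k : Fin M, y (firstIdx k) < y (secondIdx k)},
      Matrix.det (Matrix.of fun i j => φ j (y i)) =
    pairSum (fun (_ : Fin M) i j => ∫ p : ℝ × ℝ in {p | p.1 < p.2}, φ i p.1 * φ j p.2) := by
  simp only [det_eq_sum_sign_mul_prod]
  rw [integral_finsetSum _ fun σ _ =>
    ((integrable_prod_apply hφ σ).const_mul _).integrableOn, pairSum]
  refine Finset.sum_congr rfl fun σ _ => ?_
  rw [integral_const_mul, ← integral_indicator (measurableSet_pairs_lt M)]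
  congr 1
  simp only [← integral_indicator (measurableSet_lt measurable_fst measurable_snd)]
  rw [← integral_prod_pairs fun k u v => {p : ℝ × ℝ | p.1 < p.2}.indicator
    (fun p => φ (σ (firstIdx k)) p.1 * φ (σ (secondIdx k)) p.2) (u, v)]
  congr 1 with y
  simp only [Set.indicator_apply, Set.mem_ofPred_eq, Finset.prod_ite_zero, Finset.mem_univ,
    true_imp_iff, prod_eq_prod_pairs]

theorem setIntegral_pairs_lt_det_eq_factorial_mul {M : ℕ} {φ : Fin (2 * M) → ℝ → ℝ}
    (hφ : ∀ j, Integrable (φ j)) :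
    ∫ y in {y : Fin (2 * M) → ℝ | ∀ k : Fin M, y (firstIdx k) < y (secondIdx k)},
      Matrix.det (Matrix.of fun i j => φ j (y i)) =
    M.factorial * ∫ y : Fin (2 * M) → ℝ in {y | StrictMono y},
      Matrix.det (Matrix.of fun i j => φ j (y i)) := by
  have hint : Integrable fun y : Fin (2 * M) → ℝ =>
      Matrix.det (Matrix.of fun i j => φ j (y i)) := by
    simp only [det_eq_sum_sign_mul_prod]
    exact integrable_finsetSum _ fun σ _ => (integrable_prod_apply hφ σ).const_mul _
  rw [← integral_indicator (measurableSet_pairs_lt M),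
    integral_eq_sum_setIntegral_strictMono (hint.indicator (measurableSet_pairs_lt M)),
    ← pairSum_lt, pairSum, Finset.sum_mul]
  refine Finset.sum_congr rfl fun σ _ => ?_
  rw [← integral_const_mul]
  refine setIntegral_congr_fun (measurableSet_strictMono _) fun y (hy : StrictMono y) => ?_
  have hdet : Matrix.det (Matrix.of fun i j => φ j (y (σ i))) =
      Equiv.Perm.sign σ * Matrix.det (Matrix.of fun i j => φ j (y i)) :=
    Matrix.det_permute σ (Matrix.of fun i j => φ j (y i))
  simp only [Set.indicator_apply, Set.mem_ofPred_eq, hdet, Function.comp_apply, hy.lt_iff_lt,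
    Finset.prod_ite_zero, Finset.mem_univ, true_imp_iff, Finset.prod_const_one]
  split_ifs <;> simp

/-- The de Bruijn integration formula. -/
theorem setIntegral_strictMono_det_eq_pfaffian {M : ℕ} {φ : Fin (2 * M) → ℝ → ℝ}
    (hφ : ∀ j, Integrable (φ j)) {A : Fin (2 * M) → Fin (2 * M) → ℝ}
    (hA : ∀ i j, A i j = (∫ p : ℝ × ℝ in {p | p.1 < p.2}, φ i p.1 * φ j p.2) -
      ∫ p : ℝ × ℝ in {p | p.1 < p.2}, φ j p.1 * φ i p.2) :
    ∫ y : Fin (2 * M) → ℝ in {y | StrictMono y}, Matrix.det (Matrix.of fun i j => φ j (y i)) =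
      pfaffian A := by
  have hanti : ∀ i j, (if i < j then A i j else 0) - (if j < i then A j i else 0) =
      (∫ p : ℝ × ℝ in {p | p.1 < p.2}, φ i p.1 * φ j p.2) -
        ∫ p : ℝ × ℝ in {p | p.1 < p.2}, φ j p.1 * φ i p.2 := by
    intro i j
    rcases lt_trichotomy i j with h | rfl | h
    · simp [h, h.asymm, hA]
    · simp
    · simp [h, h.asymm, hA]
  rw [pfaffian_eq_pairSum, pairSum_congr_of_antisymm hanti,
    ← setIntegral_pairs_lt_det_eq_pairSum hφ, setIntegral_pairs_lt_det_eq_factorial_mul hφ]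
  field_simp

open ProbabilityTheory in
theorem setIntegral_lt_gaussianPDFReal (a b : ℝ) {v : NNReal} (hv : v ≠ 0) :
    ∫ p : ℝ × ℝ in {p | p.1 < p.2}, gaussianPDFReal a v p.1 * gaussianPDFReal b v p.2 =
      ∫ w in Set.Iic (b - a), gaussianPDFReal 0 (v + v) w := by
  have hS : MeasurableSet {p : ℝ × ℝ | p.1 < p.2} := measurableSet_lt measurable_fst measurable_snd
  have hdiff : ((gaussianReal a v).prod (gaussianReal b v)).map (fun p => p.1 - p.2) =
      (gaussianReal 0 (v + v)).map (· + (a - b)) := by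
    rw [gaussianReal_map_add_const, zero_add, sub_eq_add_neg, ← gaussianReal_conv_gaussianReal,
      ← gaussianReal_map_neg, Measure.conv, ← Measure.map_id (μ := gaussianReal a v),
      Measure.map_prod_map _ _ measurable_id measurable_neg, Measure.map_id,
      Measure.map_map (by fun_prop) (by fun_prop)]
    congr 1
  have hmeas : ((gaussianReal a v).prod (gaussianReal b v)) {p | p.1 < p.2} =
      gaussianReal 0 (v + v) (Set.Iio (b - a)) := by
    have h := DFunLike.congr_fun hdiff (Set.Iio 0)
    rw [Measure.map_apply (by fun_prop) measurableSet_Iio,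
      Measure.map_apply (by fun_prop) measurableSet_Iio] at h
    convert h using 2
    · ext p; simp
    · ext w; simp only [Set.mem_Iio, Set.mem_preimage]; constructor <;> intro _ <;> linarith
  have hvv : v + v ≠ 0 := by simpa using hv
  rw [integral_Iic_eq_integral_Iio,
    integral_eq_lintegral_of_nonneg_ae (.of_forall fun p =>
      mul_nonneg (gaussianPDFReal_nonneg _ _ _) (gaussianPDFReal_nonneg _ _ _)) ?_]
  · rw [gaussianReal_apply_eq_integral _ hvv, gaussianReal_of_var_ne_zero _ hv,
      gaussianReal_of_var_ne_zero _ hv,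
      prod_withDensity (measurable_gaussianPDF _ _) (measurable_gaussianPDF _ _),
      withDensity_apply _ hS] at hmeas
    simp only [gaussianPDF, ← ENNReal.ofReal_mul (gaussianPDFReal_nonneg _ _ _)] at hmeas
    rw [← Measure.volume_eq_prod] at hmeas
    rw [hmeas, ENNReal.toReal_ofReal
      (integral_nonneg fun w => gaussianPDFReal_nonneg _ _ _)]
  · exact (((measurable_gaussianPDFReal a v).comp measurable_fst).mul
      ((measurable_gaussianPDFReal b v).comp measurable_snd)).aestronglyMeasurable

open ProbabilityTheory in
theorem integral_Iic_sub_Iic_neg_gaussianPDFReal {t : ℝ} (ht : 0 < t) (d : ℝ) :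
    (∫ w in Set.Iic d, gaussianPDFReal 0 (t.toNNReal + t.toNNReal) w) -
      ∫ w in Set.Iic (-d), gaussianPDFReal 0 (t.toNNReal + t.toNNReal) w =
    2 / √π * ∫ v in (0 : ℝ)..(d / (2 * √t)), Real.exp (-v ^ 2) := by
  set q := gaussianPDFReal 0 (t.toNNReal + t.toNNReal) with hq
  have hint : Integrable q := integrable_gaussianPDFReal _ _
  have heven : ∫ w in (-d)..0, q w = ∫ w in (0 : ℝ)..d, q w := by
    have h := intervalIntegral.integral_comp_neg (a := 0) (b := d) q
    rw [neg_zero] at h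
    rw [← h]
    congr 1 with w
    simp [hq, gaussianPDFReal]
  have hpos : 0 < √t := Real.sqrt_pos.2 ht
  have hπ : 0 < √π := Real.sqrt_pos.2 Real.pi_pos
  have hform : ∀ w, q w = (2 * √t * √π)⁻¹ * Real.exp (-(w / (2 * √t)) ^ 2) := by
    intro w
    have h1 : √(2 * π * (t + t)) = 2 * √t * √π := by
      rw [show 2 * π * (t + t) = 2 ^ 2 * t * π by ring, Real.sqrt_mul (by positivity),
        Real.sqrt_mul (by positivity), Real.sqrt_sq (by norm_num)]
    have h2 : -w ^ 2 / (2 * (t + t)) = -(w / (2 * √t)) ^ 2 := by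
      rw [div_pow, mul_pow, Real.sq_sqrt ht.le]
      field_simp
      ring
    simp only [hq, gaussianPDFReal, NNReal.coe_add, Real.coe_toNNReal t ht.le, sub_zero, h1, h2]
  rw [intervalIntegral.integral_Iic_sub_Iic hint.integrableOn hint.integrableOn,
    ← intervalIntegral.integral_add_adjacent_intervals (b := 0) hint.intervalIntegrable
      hint.intervalIntegrable, heven]
  simp only [hform]
  rw [intervalIntegral.integral_const_mul,
    intervalIntegral.integral_comp_div (fun v => Real.exp (-v ^ 2)) (by positivity), zero_div,
    smul_eq_mul]
  field_simp
  ring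

/-- Pfaffian formula for the noncolliding probability of `N = 2M` Brownian motions:
`𝒩_N(t,x) = Pf( Ψ((x_j - x_i)/(2√t)) )` with `Ψ(u) = (2/√π)∫₀ᵘ e^{-v²}dv`, where
`𝒩_N(t,x) = ∫_{y₁<⋯<y_N} det((2πt)^{-1/2} e^{-(x_j-y_i)²/(2t)}) dy`. -/
theorem noncolliding_probability_pfaffian (M : ℕ) (t : ℝ) (ht : 0 < t)
    (x : Fin (2 * M) → ℝ) (hx : StrictMono x) :
    (∫ y : Fin (2 * M) → ℝ in {y | StrictMono y},
        Matrix.det (Matrix.of fun i j : Fin (2 * M) =>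
          (Real.sqrt (2 * π * t))⁻¹ * Real.exp (-(x j - y i) ^ 2 / (2 * t)))) =
      pfaffian (fun i j : Fin (2 * M) =>
        2 / Real.sqrt π *
          ∫ v in (0 : ℝ)..((x j - x i) / (2 * Real.sqrt t)), Real.exp (-v ^ 2)) := by
  have hφ : ∀ j s, (Real.sqrt (2 * π * t))⁻¹ * Real.exp (-(x j - s) ^ 2 / (2 * t)) =
      ProbabilityTheory.gaussianPDFReal (x j) t.toNNReal s := by
    intro j s
    rw [ProbabilityTheory.gaussianPDFReal, Real.coe_toNNReal t ht.le, sub_sq_comm]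
  have hv : t.toNNReal ≠ 0 := by simpa using ht
  simp only [hφ]
  refine setIntegral_strictMono_det_eq_pfaffian
    (fun j => ProbabilityTheory.integrable_gaussianPDFReal _ _) fun i j => ?_
  rw [setIntegral_lt_gaussianPDFReal _ _ hv, setIntegral_lt_gaussianPDFReal _ _ hv,
    ← neg_sub (x j) (x i), integral_Iic_sub_Iic_neg_gaussianPDFReal ht]
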